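/- Let Φ₁, Φ₁' : K₁ → M_{2h}(F) and Φ₂, Φ₂' : K₂ → M_{2h}(F) be F-algebra homomorphisms such that both pairs (Φ₁, Φ₂) and (Φ₁', Φ₂') are regular semisimple, and let s, s' ∈ M_{2h}(K₃) be the associated elements (relative to a fixed K₃-generator y). Then charpoly(s) = charpoly(s') (equivalently, the two pairs have the same invariant polynomial, the unique monic square root of these characteristic polynomials) if and only if there exists b ∈ GL_{2h}(F) with b·Φ₁(x)·b⁻¹ = Φ₁'(x) for all x ∈ K₁ and b·Φ₂(x)·b⁻¹ = Φ₂'(x) for all x ∈ K₂. -/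

import Mathlib

open TensorProduct

set_option synthInstance.maxHeartbeats 1000000
set_option maxHeartbeats 2000000

universe u

/-- `τ₃ = σ₁ ⊗ σ₂` on `K = K₁ ⊗[F] K₂`. -/
noncomputable def tau3 {F : Type u} [Field F] {K₁ K₂ : Type u}
    [CommRing K₁] [CommRing K₂] [Algebra F K₁] [Algebra F K₂]
    (σ₁ : K₁ ≃ₐ[F] K₁) (σ₂ : K₂ ≃ₐ[F] K₂) :
    (K₁ ⊗[F] K₂) ≃ₐ[F] (K₁ ⊗[F] K₂) :=
  Algebra.TensorProduct.congr σ₁ σ₂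

/-- `K₃ ⊆ K₁ ⊗[F] K₂`, the subalgebra of `τ₃`-fixed elements. -/
noncomputable def K3 {F : Type u} [Field F] {K₁ K₂ : Type u}
    [CommRing K₁] [CommRing K₂] [Algebra F K₁] [Algebra F K₂]
    (σ₁ : K₁ ≃ₐ[F] K₁) (σ₂ : K₂ ≃ₐ[F] K₂) : Subalgebra F (K₁ ⊗[F] K₂) :=
  AlgHom.equalizer (tau3 σ₁ σ₂).toAlgHom (AlgHom.id F _)

section

open Polynomial

theorem exists_smul_eq_zero_imp {k M : Type*} [Field k] [AddCommGroup M] [Module k[X] M]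
    {m : k[X]} (hm0 : m ≠ 0) (hm : ∀ x : M, m • x = 0) :
    ∃ v : M, ∀ q : k[X], q • v = 0 → ∀ x : M, q • x = 0 := by
  have hg : ∀ v : M, ∃ g : k[X], ∀ q : k[X], q • v = 0 ↔ g ∣ q := fun v =>
    ⟨Submodule.IsPrincipal.generator (Ideal.torsionOf k[X] M v), fun q => by
      rw [← Submodule.IsPrincipal.mem_iff_generator_dvd, Ideal.mem_torsionOf_iff]⟩
  choose g hg using hg
  have hgm : ∀ v, g v ∣ m := fun v => (hg v m).1 (hm v)
  have hg0 : ∀ v, g v ≠ 0 := fun v => ne_zero_of_dvd_ne_zero hm0 (hgm v)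
  have hdeg : ∀ v, (g v).natDegree ≤ m.natDegree := fun v => natDegree_le_of_dvd (hgm v) hm0
  let v := Function.argmin (fun v => m.natDegree - (g v).natDegree)
  have hv : ∀ w, (g w).natDegree ≤ (g v).natDegree := fun w => by
    have := Function.argmin_le (fun v => m.natDegree - (g v).natDegree) w
    have h1 := hdeg w
    have h2 := hdeg v
    simp only [v] at *
    omega
  refine ⟨v, fun q hq x => (hg x q).2 (dvd_trans ?_ ((hg v q).1 hq))⟩
  by_contra hx
  obtain ⟨p, hp, hlt⟩ : ∃ p : k[X], Prime p ∧ emultiplicity p (g v) < emultiplicity p (g x) := by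
    by_contra! H
    exact hx ((UniqueFactorizationMonoid.dvd_iff_emultiplicity_le (hg0 x)).2 fun p hp => H p hp)
  have hfv : FiniteMultiplicity p (g v) := FiniteMultiplicity.of_prime_left hp (hg0 v)
  have hfx : FiniteMultiplicity p (g x) := FiniteMultiplicity.of_prime_left hp (hg0 x)
  obtain ⟨a, ha, hpa⟩ := hfv.exists_eq_pow_mul_and_not_dvd
  obtain ⟨b, hb, hpb⟩ := hfx.exists_eq_pow_mul_and_not_dvd
  rw [hfv.emultiplicity_eq_multiplicity, hfx.emultiplicity_eq_multiplicity, Nat.cast_lt] at hlt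
  set i := multiplicity p (g v)
  set j := multiplicity p (g x)
  have hco : IsCoprime (p ^ j) a :=
    IsCoprime.pow_left ((Irreducible.coprime_iff_not_dvd hp.irreducible).2 hpa)
  have key : ∀ q : k[X], q • (p ^ i • v + b • x) = 0 → p ^ j * a ∣ q := by
    intro q hq
    have h1 : (a * q * b) • x = 0 := by
      have h2 : a • q • (p ^ i • v + b • x) = 0 := by rw [hq, smul_zero]
      have h3 : (p ^ i * a * q) • v = 0 := (hg v _).2 (ha ▸ Dvd.intro _ rfl)
      calc (a * q * b) • x = a • q • (p ^ i • v + b • x) - (p ^ i * a * q) • v := by module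
        _ = 0 := by rw [h2, h3, sub_zero]
    have h4 : p ^ j ∣ a * q := by
      have := (hg x _).1 h1
      rw [hb] at this
      have hb0 : b ≠ 0 := by rintro rfl; simp at hpb
      exact (mul_dvd_mul_iff_right hb0).1 this
    have h5 : p ^ j ∣ q := hco.dvd_of_dvd_mul_left h4
    refine hco.mul_dvd h5 ?_
    have h6 : (q * b) • x = 0 := (hg x _).2 (hb ▸ mul_dvd_mul_right h5 b)
    have h7 : (q * p ^ i) • v = 0 := by
      calc (q * p ^ i) • v = q • (p ^ i • v + b • x) - (q * b) • x := by module
        _ = 0 := by rw [hq, h6, sub_zero]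
    have := (hg v _).1 h7
    rw [ha, mul_comm q] at this
    exact (mul_dvd_mul_iff_left (pow_ne_zero i hp.ne_zero)).1 this
  have h8 := key _ ((hg (p ^ i • v + b • x) _).2 dvd_rfl)
  have h9 := natDegree_le_of_dvd h8 (hg0 _)
  have h10 := hv (p ^ i • v + b • x)
  have ha0 : a ≠ 0 := by rintro rfl; simp at hpa
  rw [natDegree_mul (pow_ne_zero _ hp.ne_zero) ha0, natDegree_pow] at h9
  rw [ha, natDegree_mul (pow_ne_zero _ hp.ne_zero) ha0, natDegree_pow] at h10
  have h11 : 0 < p.natDegree := hp.irreducible.natDegree_pos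
  nlinarith

theorem Module.End.exists_cyclic_vector {k N : Type*} [Field k] [AddCommGroup N] [Module k N]
    [FiniteDimensional k N] (t : Module.End k N)
    (ht : Module.finrank k N ≤ (minpoly k t).natDegree) :
    ∃ v : N, (∀ u, ∃ a : k[X], u = aeval t a v) ∧ ∀ q, aeval t q v = 0 ↔ t.charpoly ∣ q := by
  have hint : IsIntegral k t := Algebra.IsIntegral.isIntegral t
  have hmin : t.charpoly = minpoly k t :=
    eq_of_monic_of_dvd_of_natDegree_le (minpoly.monic hint) t.charpoly_monic
      (LinearMap.minpoly_dvd_charpoly t) (by rwa [LinearMap.charpoly_natDegree])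
  obtain ⟨v, hv⟩ := exists_smul_eq_zero_imp (M := Module.AEval' t) t.charpoly_monic.ne_zero
    (fun x => by
      obtain ⟨x, rfl⟩ := (Module.AEval'.of t).surjective x
      rw [Module.AEval'.of, ← Module.AEval.of_aeval_smul, LinearMap.aeval_self_charpoly,
        zero_smul, map_zero])
  obtain ⟨v, rfl⟩ := (Module.AEval'.of t).surjective v
  have hv' : ∀ q, aeval t q v = 0 ↔ t.charpoly ∣ q := by
    intro q
    rw [hmin]
    constructor
    · intro hq
      refine minpoly.dvd k t (LinearMap.ext fun x => ?_)
      have h1 := hv q (by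
        rw [Module.AEval'.of, ← Module.AEval.of_aeval_smul, Module.End.smul_def, hq, map_zero])
        (Module.AEval'.of t x)
      rw [Module.AEval'.of, ← Module.AEval.of_aeval_smul, Module.End.smul_def] at h1
      simpa using h1
    · rintro ⟨c, rfl⟩
      simp
  refine ⟨v, ?_, hv'⟩
  let φ : degreeLT k (Module.finrank k N) →ₗ[k] N :=
    ((LinearMap.applyₗ v).comp (aeval t).toLinearMap).comp (Submodule.subtype _)
  have hinj : Function.Injective φ := by
    rw [injective_iff_map_eq_zero]
    rintro ⟨q, hq⟩ h0
    have h1 : t.charpoly ∣ q := (hv' q).1 h0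
    ext1
    by_contra hne
    have h2 := degree_le_of_dvd h1 hne
    rw [mem_degreeLT] at hq
    have h3 := (h2.trans_lt hq)
    rw [degree_eq_natDegree t.charpoly_monic.ne_zero, LinearMap.charpoly_natDegree] at h3
    exact lt_irrefl _ h3
  have : FiniteDimensional k (degreeLT k (Module.finrank k N)) :=
    (degreeLTEquiv k (Module.finrank k N)).symm.finiteDimensional
  have hsurj : Function.Surjective φ := by
    refine (LinearMap.injective_iff_surjective_of_finrank_eq_finrank ?_).1 hinj
    rw [(degreeLTEquiv k (Module.finrank k N)).finrank_eq]
    simp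
  intro u
  obtain ⟨q, hq⟩ := hsurj u
  exact ⟨q, hq.symm⟩

section IdempotentPair

variable {k V : Type*} [Field k] [AddCommGroup V] [Module k V]

theorem IsIdempotentElem.commute_sq_add_sub_one {A : Type*} [Ring A] {e : A}
    (he : IsIdempotentElem e) {f : A} (hf : IsIdempotentElem f) :
    Commute ((e + f - 1) ^ 2) e ∧ Commute ((e + f - 1) ^ 2) f ∧
      e * f * e = (e + f - 1) ^ 2 * e ∧ f * e * f = (e + f - 1) ^ 2 * f := by
  have h1 : e * e = e := he
  have h2 : f * f = f := hf
  have key : (e + f - 1) ^ 2 = 1 - e - f + e * f + f * e := by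
    rw [pow_two]; noncomm_ring; rw [h1, h2]; abel
  have h3 : ∀ x, e * (e * x) = e * x := fun x => by rw [← mul_assoc, h1]
  have h4 : ∀ x, f * (f * x) = f * x := fun x => by rw [← mul_assoc, h2]
  rw [key]
  refine ⟨?_, ?_, ?_, ?_⟩ <;> try unfold Commute SemiconjBy
  all_goals
    simp only [mul_add, add_mul, mul_sub, sub_mul, mul_one, one_mul, mul_assoc, h1, h2, h3, h4]
    abel

theorem exists_cyclic_of_idempotent_pair [FiniteDimensional k V] {e f s : Module.End k V}
    (he : IsIdempotentElem e) (hf : IsIdempotentElem f) (hs : s = (e + f - 1) ^ 2)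
    (hu : IsUnit (e + f - 1)) (hu' : IsUnit (e - f))
    (hdeg : Module.finrank k V ≤ 2 * (minpoly k s).natDegree) :
    ∃ (v : V) (χ : k[X]), e v = v ∧ χ.Monic ∧ χ ^ 2 = s.charpoly ∧
      (∀ x, ∃ a b : k[X], x = aeval s a v + f (aeval s b v)) ∧
      ∀ a b : k[X], aeval s a v + f (aeval s b v) = 0 ↔ χ ∣ a ∧ χ ∣ b := by
  obtain ⟨hse, hsf, hefe, hfef⟩ := he.commute_sq_add_sub_one hf
  rw [← hs] at hse hsf hefe hfef
  have hsu : IsUnit s := hs ▸ hu.pow 2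
  have hsinj : ∀ x, s x = 0 → x = 0 := fun x hx =>
    ((Module.End.isUnit_iff s).1 hsu).1 (hx.trans (map_zero s).symm)
  have hdinj : ∀ x, (e - f) x = 0 → x = 0 := fun x hx =>
    ((Module.End.isUnit_iff _).1 hu').1 (hx.trans (map_zero _).symm)
  have hee : ∀ x, e (e x) = e x := fun x => LinearMap.congr_fun he x
  have hff : ∀ x, f (f x) = f x := fun x => LinearMap.congr_fun hf x
  have hse' : ∀ x, s (e x) = e (s x) := fun x => LinearMap.congr_fun hse x
  have hsf' : ∀ x, s (f x) = f (s x) := fun x => LinearMap.congr_fun hsf x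
  have hefe' : ∀ x, e (f (e x)) = s (e x) := fun x => LinearMap.congr_fun hefe x
  have hfef' : ∀ x, f (e (f x)) = s (f x) := fun x => LinearMap.congr_fun hfef x
  let N := LinearMap.range e
  have hN : ∀ u : N, e u = u := by rintro ⟨_, x, rfl⟩; exact hee x
  have hsN : ∀ x ∈ N, s x ∈ N := by rintro _ ⟨x, rfl⟩; exact ⟨s x, (hse' x).symm⟩
  let t : Module.End k N := s.restrict hsN
  have ht : ∀ u : N, ((t u : N) : V) = s u := fun u => rfl
  have hta : ∀ (q : k[X]) (u : N), ((aeval t q u : N) : V) = aeval s q (u : V) := by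
    intro q u
    induction q using Polynomial.induction_on' with
    | add p q hp hq => simp [hp, hq]
    | monomial n a =>
      simp only [aeval_monomial, Module.End.mul_apply, Module.algebraMap_end_apply,
        Submodule.coe_smul]
      congr 1
      induction n with
      | zero => simp
      | succ n ih => simp only [pow_succ', Module.End.mul_apply, ht, ih]
  have hsfa : ∀ (q : k[X]) (x : V), aeval s q (f x) = f (aeval s q x) := fun q x =>
    LinearMap.congr_fun (Algebra.commute_of_mem_adjoin_singleton_of_commute
      (aeval_mem_adjoin_singleton k s) hsf.symm).symm.eq x
  let φ : N × N →ₗ[k] V := N.subtype.coprod (f.comp N.subtype)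
  have hφ : ∀ u w, φ (u, w) = u + f w := fun u w => rfl
  have hzero : ∀ u w : N, (u : V) + f w = 0 → u = 0 ∧ w = 0 := by
    intro u w huw
    have h1 : (u : V) = - f w := eq_neg_of_add_eq_zero_left huw
    have h2 : f (u : V) = u := by rw [h1, map_neg, hff]
    have h3 : (u : V) = 0 := hdinj _ (by rw [LinearMap.sub_apply, hN, h2, sub_self])
    have h4 : f (w : V) = 0 := by rw [h3, zero_add] at huw; exact huw
    have h5 : (w : V) = 0 := hsinj _ (by rw [← hN w, ← hefe', hN, h4, map_zero])
    exact ⟨Subtype.ext h3, Subtype.ext h5⟩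
  have hφi : Function.Injective φ := by
    rw [injective_iff_map_eq_zero]
    rintro ⟨u, w⟩ huw
    obtain ⟨rfl, rfl⟩ := hzero u w huw
    rfl
  have hφs : Function.Surjective φ := by
    intro x
    obtain ⟨z, rfl⟩ := ((Module.End.isUnit_iff _).1 hu').2 x
    obtain ⟨z', rfl⟩ := ((Module.End.isUnit_iff _).1 hsu).2 z
    refine ⟨(⟨e (s z'), _, rfl⟩, ⟨-e (f z'), -f z', by simp⟩), ?_⟩
    rw [hφ]
    simp only [map_neg, hfef', LinearMap.sub_apply, hsf']
    abel
  let Φ : (N × N) ≃ₗ[k] V := LinearEquiv.ofBijective φ ⟨hφi, hφs⟩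
  have hfin : Module.finrank k V = 2 * Module.finrank k N := by
    rw [← Φ.finrank_eq, Module.finrank_prod, two_mul]
  have hchar : s.charpoly = t.charpoly ^ 2 := by
    have : s = Φ.conj (t.prodMap t) := by
      refine LinearMap.ext fun x => ?_
      obtain ⟨⟨u, w⟩, rfl⟩ := Φ.surjective x
      rw [LinearEquiv.conj_apply_apply, LinearEquiv.symm_apply_apply]
      change s (u + f w) = (t u : V) + f (t w : V)
      rw [map_add, hsf', ht, ht]
    rw [this, LinearEquiv.charpoly_conj, LinearMap.charpoly_prodMap, pow_two]
  have hmin : minpoly k s ∣ minpoly k t := by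
    refine minpoly.dvd k s (LinearMap.ext fun x => ?_)
    obtain ⟨⟨u, w⟩, rfl⟩ := Φ.surjective x
    change aeval s (minpoly k t) (u + f w) = 0
    rw [map_add, hsfa, ← hta, ← hta, minpoly.aeval]
    simp
  obtain ⟨v, hv1, hv2⟩ := Module.End.exists_cyclic_vector t (by
    have := natDegree_le_of_dvd hmin (minpoly.ne_zero (Algebra.IsIntegral.isIntegral t))
    omega)
  refine ⟨v, t.charpoly, hN v, t.charpoly_monic, hchar.symm, fun x => ?_, fun a b => ?_⟩
  · obtain ⟨⟨u, w⟩, rfl⟩ := Φ.surjective x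
    obtain ⟨a, ha⟩ := hv1 u
    obtain ⟨b, hb⟩ := hv1 w
    refine ⟨a, b, ?_⟩
    change (u : V) + f w = _
    rw [ha, hb, hta, hta]
  · rw [← hta, ← hta, ← hv2, ← hv2]
    refine ⟨fun hab => hzero _ _ hab, fun ⟨h1, h2⟩ => ?_⟩
    rw [h1, h2]
    simp

theorem idempotent_pair_apply_cyclic {e f s : Module.End k V}
    (he : IsIdempotentElem e) (hf : IsIdempotentElem f) (hs : s = (e + f - 1) ^ 2)
    {v : V} (hv : e v = v)
    (a b : k[X]) :
    e (aeval s a v + f (aeval s b v)) = aeval s (a + X * b) v + f (aeval s (0 : k[X]) v) ∧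
    f (aeval s a v + f (aeval s b v)) = aeval s (0 : k[X]) v + f (aeval s (a + b) v) := by
  obtain ⟨hse, hsf, hefe, hfef⟩ := he.commute_sq_add_sub_one hf
  rw [← hs] at hse hsf hefe hfef
  have hsea : ∀ (q : k[X]), e (aeval s q v) = aeval s q v := fun q => by
    have := LinearMap.congr_fun (Algebra.commute_of_mem_adjoin_singleton_of_commute
      (aeval_mem_adjoin_singleton k (p := q) s) hse.symm).eq v
    rwa [Module.End.mul_apply, Module.End.mul_apply, hv] at this
  have hff : ∀ x, f (f x) = f x := fun x => LinearMap.congr_fun hf x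
  have hefe' : ∀ x, e (f (e x)) = s (e x) := fun x => LinearMap.congr_fun hefe x
  constructor
  · have := hefe' (aeval s b v)
    rw [hsea] at this
    simp [hsea, this]
  · simp [hff]

theorem exists_linearEquiv_of_idempotent_pair [FiniteDimensional k V]
    {e f s e' f' s' : Module.End k V}
    (he : IsIdempotentElem e) (hf : IsIdempotentElem f) (hs : s = (e + f - 1) ^ 2)
    (hu : IsUnit (e + f - 1)) (hu' : IsUnit (e - f))
    (hdeg : Module.finrank k V ≤ 2 * (minpoly k s).natDegree)
    (he' : IsIdempotentElem e') (hf' : IsIdempotentElem f') (hs' : s' = (e' + f' - 1) ^ 2)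
    (hv : IsUnit (e' + f' - 1)) (hv' : IsUnit (e' - f'))
    (hdeg' : Module.finrank k V ≤ 2 * (minpoly k s').natDegree)
    (hss' : s.charpoly = s'.charpoly) :
    ∃ g : V ≃ₗ[k] V, (∀ x, g (e x) = e' (g x)) ∧ ∀ x, g (f x) = f' (g x) := by
  obtain ⟨v, χ, hev, hχ, hχ2, hsurj, hker⟩ :=
    exists_cyclic_of_idempotent_pair he hf hs hu hu' hdeg
  obtain ⟨w, ξ, hew, hξ, hξ2, hsurj', hker'⟩ :=
    exists_cyclic_of_idempotent_pair he' hf' hs' hv hv' hdeg'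
  have hχξ : χ = ξ := by
    have h1 : χ ^ 2 = ξ ^ 2 := by rw [hχ2, hξ2, hss']
    rcases sq_eq_sq_iff_eq_or_eq_neg.1 h1 with h | h
    · exact h
    · have h2 := congrArg Polynomial.leadingCoeff h
      rw [leadingCoeff_neg, hχ.leadingCoeff, hξ.leadingCoeff] at h2
      rw [h, ← one_mul ξ, ← neg_mul, ← C_1, ← C_neg, ← h2]
  subst hχξ
  let π : (e f s : Module.End k V) → V → (k[X] × k[X]) →ₗ[k] V := fun e f s v =>
    LinearMap.coprod ((LinearMap.applyₗ v).comp (aeval s).toLinearMap)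
      (f.comp ((LinearMap.applyₗ v).comp (aeval s).toLinearMap))
  let p := π e f s v
  let p' := π e' f' s' w
  have hp : ∀ a b, p (a, b) = aeval s a v + f (aeval s b v) := fun a b => rfl
  have hp' : ∀ a b, p' (a, b) = aeval s' a w + f' (aeval s' b w) := fun a b => rfl
  have hps : Function.Surjective p := fun x => by
    obtain ⟨a, b, rfl⟩ := hsurj x
    exact ⟨(a, b), rfl⟩
  have hps' : Function.Surjective p' := fun x => by
    obtain ⟨a, b, rfl⟩ := hsurj' x
    exact ⟨(a, b), rfl⟩
  have hk : LinearMap.ker p = LinearMap.ker p' := by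
    ext ⟨a, b⟩
    rw [LinearMap.mem_ker, LinearMap.mem_ker, hp, hp', hker, hker']
  let g : V ≃ₗ[k] V := (p.quotKerEquivOfSurjective hps).symm ≪≫ₗ
    (Submodule.quotEquivOfEq _ _ hk ≪≫ₗ p'.quotKerEquivOfSurjective hps')
  have hg : ∀ z, g (p z) = p' z := by
    intro z
    have : (p.quotKerEquivOfSurjective hps).symm (p z) = Submodule.Quotient.mk z := by
      rw [LinearEquiv.symm_apply_eq]; rfl
    simp only [g, LinearEquiv.trans_apply, this]
    rfl
  refine ⟨g, fun x => ?_, fun x => ?_⟩ <;> obtain ⟨⟨a, b⟩, rfl⟩ := hps x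
  · rw [hg, hp, hp', (idempotent_pair_apply_cyclic he hf hs hev a b).1,
      (idempotent_pair_apply_cyclic he' hf' hs' hew a b).1,
      ← hp, ← hp', hg]
  · rw [hg, hp, hp', (idempotent_pair_apply_cyclic he hf hs hev a b).2,
      (idempotent_pair_apply_cyclic he' hf' hs' hew a b).2,
      ← hp, ← hp', hg]

theorem exists_aeval_of_commute_idempotent_pair [FiniteDimensional k V] {e f s : Module.End k V}
    (he : IsIdempotentElem e) (hf : IsIdempotentElem f) (hs : s = (e + f - 1) ^ 2)
    (hu : IsUnit (e + f - 1)) (hu' : IsUnit (e - f))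
    (hdeg : Module.finrank k V ≤ 2 * (minpoly k s).natDegree)
    {c : Module.End k V} (hce : Commute c e) (hcf : Commute c f) : ∃ q : k[X], c = aeval s q := by
  obtain ⟨v, χ, hev, hχ, hχ2, hsurj, hker⟩ :=
    exists_cyclic_of_idempotent_pair he hf hs hu hu' hdeg
  obtain ⟨a, b, hab⟩ := hsurj (c v)
  have h1 : c v = aeval s (a + X * b) v := by
    have := (idempotent_pair_apply_cyclic he hf hs hev a b).1
    rw [← hab, ← Module.End.mul_apply, ← hce.eq, Module.End.mul_apply, hev] at this
    simpa using this
  have hcs : Commute c s := hs ▸ ((hce.add_right hcf).sub_right (Commute.one_right c)).pow_right 2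
  have hca : ∀ q : k[X], Commute c (aeval s q) := fun q =>
    Algebra.commute_of_mem_adjoin_singleton_of_commute (aeval_mem_adjoin_singleton k s) hcs
  have hsf : Commute f s := by
    rw [hs]; exact (he.commute_sq_add_sub_one hf).2.1.symm
  have hfa : ∀ q : k[X], Commute f (aeval s q) := fun q =>
    Algebra.commute_of_mem_adjoin_singleton_of_commute (aeval_mem_adjoin_singleton k s) hsf
  have h2 : ∀ q : k[X], c (aeval s q v) = aeval s (a + X * b) (aeval s q v) := fun q => by
    rw [← Module.End.mul_apply, (hca q).eq, Module.End.mul_apply, h1, ← Module.End.mul_apply,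
      ← Module.End.mul_apply, ← map_mul, ← map_mul, mul_comm]
  refine ⟨a + X * b, LinearMap.ext fun x => ?_⟩
  obtain ⟨p, q, rfl⟩ := hsurj x
  have h3 : ∀ x, c (f x) = f (c x) := fun x => LinearMap.congr_fun hcf.eq x
  have h4 : ∀ (r : k[X]) x, f (aeval s r x) = aeval s r (f x) := fun r x =>
    LinearMap.congr_fun (hfa r).eq x
  rw [map_add, map_add, h2, h3, h2, h4]

end IdempotentPair

theorem Matrix.exists_intertwining_unit_of_baseChange {F Ω ι n : Type*} [Field F] [Field Ω]
    [Algebra F Ω] [FiniteDimensional F Ω] [Fintype n] [DecidableEq n] (A A' : ι → Matrix n n F)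
    (hcomm : ∀ c d : Matrix n n F, (∀ i, Commute c (A i)) → (∀ i, Commute d (A i)) → Commute c d)
    {g g' : Matrix n n Ω}
    (hg : ∀ i, g * (A i).map (algebraMap F Ω) = (A' i).map (algebraMap F Ω) * g)
    (hg' : ∀ i, g' * (A' i).map (algebraMap F Ω) = (A i).map (algebraMap F Ω) * g')
    (hgg : g' * g = 1) :
    ∃ b : (Matrix n n F)ˣ, ∀ i, (b : Matrix n n F) * A i = A' i * b := by
  classical
  have hr : ∀ (ℓ : Ω →ₗ[F] F) (x : Matrix n n Ω) (a : Matrix n n F),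
      (x * a.map (algebraMap F Ω)).map ℓ = x.map ℓ * a := by
    intro ℓ x a
    ext i j
    simp only [Matrix.map_apply, Matrix.mul_apply, map_sum]
    refine Finset.sum_congr rfl fun k _ => ?_
    rw [mul_comm, ← Algebra.smul_def, map_smul, smul_eq_mul, mul_comm]
  have hl : ∀ (ℓ : Ω →ₗ[F] F) (x : Matrix n n Ω) (a : Matrix n n F),
      (a.map (algebraMap F Ω) * x).map ℓ = a * x.map ℓ := by
    intro ℓ x a
    ext i j
    simp only [Matrix.map_apply, Matrix.mul_apply, map_sum]
    refine Finset.sum_congr rfl fun k _ => ?_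
    rw [← Algebra.smul_def, map_smul, smul_eq_mul]
  let E : Subalgebra F (Matrix n n F) := Subalgebra.centralizer F (Set.range A)
  have hE : ∀ {c}, c ∈ E ↔ ∀ i, Commute c (A i) := by
    intro c
    simp only [E, Subalgebra.mem_centralizer_iff, Set.forall_mem_range]
    exact forall_congr' fun i => ⟨fun h => h.symm, fun h => h.symm⟩
  let _ : CommRing E :=
    { (inferInstance : Ring E) with
      mul_comm := fun c d => Subtype.ext (hcomm c d (hE.1 c.2) (hE.1 d.2)) }
  have : IsArtinianRing E := IsArtinianRing.of_finite F E
  let H : Submodule F (Matrix n n F) :=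
    { carrier := {x | ∀ i, x * A i = A' i * x}
      add_mem' := fun {a b} ha hb i => by rw [add_mul, mul_add, ha i, hb i]
      zero_mem' := fun i => by simp
      smul_mem' := fun c x hx i => by simp [hx i] }
  let H' : Submodule F (Matrix n n F) :=
    { carrier := {x | ∀ i, x * A' i = A i * x}
      add_mem' := fun {a b} ha hb i => by rw [add_mul, mul_add, ha i, hb i]
      zero_mem' := fun i => by simp
      smul_mem' := fun c x hx i => by simp [hx i] }
  have hHH : ∀ x ∈ H', ∀ y ∈ H, x * y ∈ E := fun x hx y hy => hE.2 fun i => by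
    change x * y * A i = A i * (x * y)
    rw [mul_assoc, hy i, ← mul_assoc, hx i, mul_assoc]
  have hHE : ∀ x ∈ H, ∀ c ∈ E, x * c ∈ H := fun x hx c hc i => by
    rw [mul_assoc, (hE.1 hc i).eq, ← mul_assoc, hx i, mul_assoc]
  have hEH : ∀ x ∈ H', ∀ c ∈ E, c * x ∈ H' := fun x hx c hc i => by
    rw [mul_assoc, hx i, ← mul_assoc, (hE.1 hc i).eq, mul_assoc]
  let ω := Module.finBasis F Ω
  obtain ⟨ℓ, hℓ⟩ := LinearMap.exists_leftInverse_of_injective (Algebra.linearMap F Ω)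
    (LinearMap.ker_eq_bot.2 (algebraMap F Ω).injective)
  have hone : ∑ i, ∑ j, ℓ (ω i * ω j) • ((g'.map (ω.coord i)) * (g.map (ω.coord j))) = 1 := by
    have h1 : (1 : Matrix n n F) = (g' * g).map ℓ := by
      rw [hgg]
      have h2 : ℓ 1 = 1 := by simpa using LinearMap.congr_fun hℓ 1
      ext i j
      by_cases hij : i = j
      · subst hij; simp [h2]
      · simp [hij]
    rw [h1]
    ext a c
    simp only [Matrix.sum_apply, Matrix.smul_apply, Matrix.mul_apply, Matrix.map_apply, map_sum,
      smul_eq_mul, Finset.mul_sum]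
    have h3 : ∀ x z : Ω, ℓ (x * z) = ∑ i, ∑ j, ℓ (ω i * ω j) * (ω.coord i x * ω.coord j z) := by
      intro x z
      conv_lhs => rw [← ω.sum_repr x, ← ω.sum_repr z]
      rw [Finset.sum_mul_sum, map_sum]
      refine Finset.sum_congr rfl fun i _ => ?_
      rw [map_sum]
      refine Finset.sum_congr rfl fun j _ => ?_
      rw [smul_mul_smul_comm, map_smul, smul_eq_mul, mul_comm]
      rfl
    refine Eq.trans ?_ (Finset.sum_congr rfl fun p _ => h3 (g' a p) (g p c)).symm
    symm
    rw [Finset.sum_comm]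
    refine Finset.sum_congr rfl fun i _ => ?_
    rw [Finset.sum_comm]
  have hmem : ∀ i, g.map (ω.coord i) ∈ H := fun i j => by
    rw [← hr, hg, hl]
  have hmem' : ∀ i, g'.map (ω.coord i) ∈ H' := fun i j => by
    rw [← hr, hg', hl]
  have hex : ∀ m : MaximalSpectrum E, ∃ x : H', ∃ y : H,
      (⟨x * y, hHH x x.2 y y.2⟩ : E) ∉ m.asIdeal := by
    intro m
    by_contra! hm
    refine m.isMaximal.ne_top ((Ideal.eq_top_iff_one _).2 ?_)
    have : (1 : E) = ∑ i, ∑ j, ℓ (ω i * ω j) •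
        (⟨_, hHH _ (hmem' i) _ (hmem j)⟩ : E) := by
      refine Subtype.ext ?_
      rw [OneMemClass.coe_one, ← hone]
      simp only [AddSubmonoidClass.coe_finsetSum, Subalgebra.coe_smul]
    rw [this]
    refine Submodule.sum_mem _ fun i _ => Submodule.sum_mem _ fun j _ => ?_
    rw [Algebra.smul_def]
    exact Ideal.mul_mem_left _ _ (hm ⟨_, hmem' i⟩ ⟨_, hmem j⟩)
  choose x y hxy using hex
  have := Fintype.ofFinite (MaximalSpectrum E)
  have hε : ∀ m : MaximalSpectrum E, ∃ ε : E, ∀ m' : MaximalSpectrum E,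
      ε - (if m = m' then 1 else 0) ∈ m'.asIdeal := fun m =>
    Ideal.exists_forall_sub_mem_ideal (I := fun m : MaximalSpectrum E => m.asIdeal)
      (fun m m' hmm => Ideal.isCoprime_of_isMaximal fun h => hmm (MaximalSpectrum.ext h)) _
  choose ε hε using hε
  let X : Matrix n n F := ∑ m, (ε m : Matrix n n F) * x m
  let Y : Matrix n n F := ∑ m, y m * (ε m : Matrix n n F)
  have hX : X ∈ H' := Submodule.sum_mem _ fun m _ => hEH _ (x m).2 _ (ε m).2
  have hY : Y ∈ H := Submodule.sum_mem _ fun m _ => hHE _ (y m).2 _ (ε m).2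
  let z : E := ∑ m, ∑ m', ε m * ⟨x m * y m', hHH _ (x m).2 _ (y m').2⟩ * ε m'
  have hz : (z : Matrix n n F) = X * Y := by
    simp only [z, X, Y, AddSubmonoidClass.coe_finsetSum, Finset.sum_mul_sum]
    refine Finset.sum_congr rfl fun m _ => Finset.sum_congr rfl fun m' _ => ?_
    change (ε m : Matrix n n F) * (x m * y m') * ε m' = _
    simp only [mul_assoc]
  have hzu : IsUnit z := by
    by_contra hz'
    obtain ⟨I, hI, hzI⟩ := exists_max_ideal_of_mem_nonunits hz'
    let m : MaximalSpectrum E := ⟨I, hI⟩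
    have hq : ∀ m', Ideal.Quotient.mk I (ε m') = if m' = m then 1 else 0 := fun m' => by
      have := Ideal.Quotient.eq.2 (hε m' m)
      rw [this]
      split_ifs <;> simp
    refine hxy m ?_
    have h1 := Ideal.Quotient.eq_zero_iff_mem.2 hzI
    simp only [z, map_sum, map_mul, hq, ite_mul, mul_ite, one_mul, zero_mul, mul_one, mul_zero,
      Finset.sum_ite_eq', Finset.mem_univ, if_true] at h1
    simpa using Ideal.Quotient.eq_zero_iff_mem.1 h1
  have hXY : IsUnit (X * Y) := hz ▸ hzu.map E.val
  have hYu : IsUnit Y := by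
    rw [Matrix.isUnit_iff_isUnit_det, Matrix.det_mul] at hXY
    rw [Matrix.isUnit_iff_isUnit_det]
    exact isUnit_of_mul_isUnit_right hXY
  exact ⟨hYu.unit, fun i => hY i⟩

theorem Matrix.le_natDegree_minpoly_map {R Ω n : Type*} [CommRing R] [IsSemisimpleRing R] [Field Ω]
    [Fintype n] [DecidableEq n] (ψ : R →+* Ω) (s : Matrix n n R)
    [Module.Free R (Algebra.adjoin R {s})] :
    Module.finrank R (Algebra.adjoin R {s}) ≤ (minpoly Ω (s.map ψ)).natDegree := by
  have : Nontrivial R := ψ.domain_nontrivial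
  rcases Nat.eq_zero_or_pos (Module.finrank R (Algebra.adjoin R {s})) with h0 | hpos
  · omega
  have := Module.finite_of_finrank_pos hpos
  let b := Module.finBasis R (Algebra.adjoin R {s})
  obtain ⟨Q, hQ⟩ := exists_isCompl (Subalgebra.toSubmodule (Algebra.adjoin R {s}))
  let c : Fin (Module.finrank R (Algebra.adjoin R {s})) → (Matrix n n R →ₗ[R] R) :=
    fun i => (b.coord i).comp (Submodule.projectionOnto _ Q hQ)
  have hc : ∀ i j, c i (b j : Matrix n n R) = if j = i then 1 else 0 := by
    intro i j
    have : Submodule.projectionOnto _ Q hQ (b j : Matrix n n R) = b j :=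
      Submodule.projectionOnto_apply_left hQ (b j)
    change b.coord i (Submodule.projectionOnto _ Q hQ (b j : Matrix n n R)) = _
    rw [this]
    simp [Finsupp.single_apply]
  let L : Fin (Module.finrank R (Algebra.adjoin R {s})) → (Matrix n n Ω →ₗ[Ω] Ω) := fun i =>
    ∑ p, ∑ q, ψ (c i (Matrix.single p q 1)) • Matrix.entryLinearMap Ω Ω p q
  have hL : ∀ i (x : Matrix n n R), L i (x.map ψ) = ψ (c i x) := by
    intro i x
    conv_rhs => rw [Matrix.matrix_eq_sum_single x]
    simp only [L, map_sum, LinearMap.sum_apply, LinearMap.smul_apply, Matrix.entryLinearMap_apply,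
      Matrix.map_apply, smul_eq_mul, ← map_mul]
    refine Finset.sum_congr rfl fun p _ => Finset.sum_congr rfl fun q _ => ?_
    rw [mul_comm, ← smul_eq_mul, ← map_smul, Matrix.smul_single, smul_eq_mul, mul_one]
  have hli : LinearIndependent Ω fun j => (b j : Matrix n n R).map ψ := by
    rw [Fintype.linearIndependent_iff]
    intro d hd i
    simpa [hL, hc] using congrArg (L i) hd
  have hint : IsIntegral Ω (s.map ψ) := Algebra.IsIntegral.isIntegral _
  have hmem : ∀ j, (b j : Matrix n n R).map ψ ∈
      Subalgebra.toSubmodule (Algebra.adjoin Ω {s.map ψ}) := by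
    intro j
    obtain ⟨q, hq⟩ : ∃ q : R[X], aeval s q = (b j : Matrix n n R) :=
      (Algebra.adjoin_singleton_eq_range_aeval R s).le (b j).2
    have h2 : aeval (s.map ψ) (q.map ψ) = (b j : Matrix n n R).map ψ := by
      rw [← hq]
      refine (Polynomial.map_aeval_eq_aeval_map (φ := ψ) (ψ := ψ.mapMatrix) ?_ q s).symm
      ext r i j
      by_cases hij : i = j
      · subst hij; simp [Matrix.algebraMap_matrix_apply]
      · simp [Matrix.algebraMap_matrix_apply, hij]
    rw [← h2]
    exact aeval_mem_adjoin_singleton Ω _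
  rw [← Submodule.span_range_natDegree_eq_adjoin (minpoly.monic hint) (minpoly.aeval _ _)] at hmem
  have hli' := (LinearIndependent.of_comp (Submodule.subtype _) hli :
    LinearIndependent Ω fun j => (⟨_, hmem j⟩ : Submodule.span Ω _))
  have h1 := hli'.fintype_card_le_finrank
  rw [Fintype.card_fin] at h1
  refine h1.trans ((finrank_span_finset_le_card _).trans
    ((@Finset.card_image_le _ _ _ _ (_)).trans ?_))
  simp

section Quadratic

variable {F K₁ : Type*} [Field F] [CommRing K₁] [Algebra F K₁]

theorem exists_isUnit_sub_of_quadratic_etale [Algebra.Etale F K₁]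
    (hdim : Module.finrank F K₁ = 2) (σ : K₁ ≃ₐ[F] K₁) (hσ : ∀ x, σ (σ x) = x)
    (hfix : ∀ x, σ x = x ↔ ∃ a : F, algebraMap F K₁ a = x) : ∃ a, IsUnit (a - σ a) := by
  have : IsReduced K₁ := Algebra.FormallyUnramified.isReduced_of_field F K₁
  obtain ⟨a, ha⟩ : ∃ a, σ a ≠ a := by
    by_contra! hall
    have hsurj : Function.Surjective (Algebra.linearMap F K₁) := fun x => (hfix x).1 (hall x)
    have := LinearMap.finrank_le_finrank_of_surjective hsurj
    rw [hdim, Module.finrank_self] at this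
    omega
  refine ⟨a, ?_⟩
  obtain ⟨c, hc⟩ := (hfix ((a - σ a) ^ 2)).1 (by rw [map_pow, map_sub, hσ]; ring)
  have hc0 : c ≠ 0 := by
    rintro rfl
    rw [map_zero] at hc
    have := pow_eq_zero_iff (two_ne_zero) |>.1 hc.symm
    exact ha (sub_eq_zero.1 this).symm
  rw [← isUnit_pow_iff two_ne_zero, ← hc]
  exact (isUnit_iff_ne_zero.2 hc0).map _

theorem quadratic_idempotent {σ : K₁ ≃ₐ[F] K₁} (hσ : ∀ x, σ (σ x) = x)
    (hfix : ∀ x, σ x = x ↔ ∃ a : F, algebraMap F K₁ a = x) {a : K₁} (ha : IsUnit (a - σ a))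
    {Ω A : Type*} [Field Ω] [Algebra F Ω] [Ring A] [Algebra F A] [Algebra Ω A]
    [IsScalarTower F Ω A] (φ : K₁ →ₐ[F] Ω) (Φ : K₁ →ₐ[F] A) {e : A}
    (he : e = (φ a - φ (σ a))⁻¹ • (Φ a - φ (σ a) • 1)) :
    IsIdempotentElem e ∧ ∀ x, Φ x = φ x • e + φ (σ x) • (1 - e) := by
  have hr : φ a - φ (σ a) ≠ 0 := by rw [← map_sub]; exact (ha.map φ).ne_zero
  have hΦa : Φ a = φ a • e + φ (σ a) • (1 - e) := by
    have : (φ a - φ (σ a)) • e = Φ a - φ (σ a) • 1 := by rw [he, smul_inv_smul₀ hr]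
    rw [eq_sub_iff_add_eq] at this
    rw [← this]
    module
  have hF : ∀ c : F, Φ (algebraMap F K₁ c) = algebraMap Ω A (algebraMap F Ω c) := fun c => by
    rw [AlgHom.commutes, ← IsScalarTower.algebraMap_apply]
  have hFφ : ∀ c : F, φ (algebraMap F K₁ c) = algebraMap F Ω c := fun c => φ.commutes c
  constructor
  · obtain ⟨T, hT⟩ := (hfix (a + σ a)).1 (by rw [map_add, hσ, add_comm])
    obtain ⟨N, hN⟩ := (hfix (a * σ a)).1 (by rw [map_mul, hσ, mul_comm])
    have h1 : Φ a * Φ a = (φ a + φ (σ a)) • Φ a - (φ a * φ (σ a)) • 1 := by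
      have h2 : a * a = algebraMap F K₁ T * a - algebraMap F K₁ N := by rw [hT, hN]; ring
      rw [← map_mul, h2, map_sub, map_mul, hF, hF, ← hFφ, ← hFφ, hT, hN, map_add, map_mul,
        Algebra.smul_def, Algebra.algebraMap_eq_smul_one (φ a * φ (σ a))]
    have h3 : (φ a - φ (σ a)) • (φ a - φ (σ a)) • (e * e) =
        (φ a - φ (σ a)) • (φ a - φ (σ a)) • e := by
      have : (φ a - φ (σ a)) • e = Φ a - φ (σ a) • 1 := by rw [he, smul_inv_smul₀ hr]
      rw [← mul_smul_comm, ← smul_mul_assoc, this]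
      simp only [mul_sub, sub_mul, h1, mul_smul_comm, smul_mul_assoc, mul_one, one_mul]
      module
    exact smul_right_injective A hr (smul_right_injective A hr h3)
  · intro x
    obtain ⟨δ, hδ⟩ := ha
    have hσδ : σ (↑δ⁻¹ : K₁) = -(↑δ⁻¹ : K₁) := by
      have h1 : σ (δ : K₁) = -δ := by rw [hδ, map_sub, hσ]; ring
      have h2 : (δ : K₁) * σ (↑δ⁻¹ : K₁) = δ * (-(↑δ⁻¹ : K₁)) := by
        have h3 : σ (δ : K₁) * σ (↑δ⁻¹ : K₁) = 1 := by rw [← map_mul]; simp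
        rw [h1] at h3
        rw [mul_neg, Units.mul_inv]
        linear_combination -h3
      exact δ.isUnit.mul_left_cancel h2
    obtain ⟨d, hd⟩ := (hfix ((x - σ x) * ↑δ⁻¹)).1 (by rw [map_mul, map_sub, hσ, hσδ]; ring)
    have hd' : algebraMap F K₁ d * (a - σ a) = x - σ x := by
      rw [hd, ← hδ, mul_assoc, Units.inv_mul, mul_one]
    obtain ⟨c, hc⟩ := (hfix (x - algebraMap F K₁ d * a)).1 (by
      rw [map_sub, map_mul, AlgEquiv.commutes]; linear_combination hd')
    have hx : x = algebraMap F K₁ c + algebraMap F K₁ d * a := by rw [hc]; ring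
    rw [hx]
    simp only [map_add, map_mul, AlgEquiv.commutes, hF, hFφ, hΦa]
    rw [← Algebra.smul_def, Algebra.algebraMap_eq_smul_one]
    module

theorem apply_generator_of_quadratic {σ : K₁ ≃ₐ[F] K₁} {a : K₁} (ha : IsUnit (a - σ a))
    {K : Type*} [CommRing K] [Algebra F K] {τ : K ≃ₐ[F] K} (i : K₁ →ₐ[F] K)
    (hi : ∀ x, τ (i x) = i (σ x)) {y : K}
    (hy : ∀ k, ∃ c d, τ c = c ∧ τ d = d ∧ k = c + d * y)
    {Ω A : Type*} [Field Ω] [Algebra F Ω] [Ring A] [Algebra F A] [Algebra Ω A]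
    (ψ : K →ₐ[F] Ω) (θ : K →ₐ[F] A) (hθ : ∀ c, τ c = c → θ c = ψ c • 1) {e : A}
    (he : ∀ x, θ (i x) = ψ (i x) • e + ψ (i (σ x)) • (1 - e)) :
    θ y = ψ y • e + ψ (τ y) • (1 - e) := by
  obtain ⟨c, d, hc, hd, hk⟩ := hy (i a)
  have hk' : i (σ a) = c + d * τ y := by rw [← hi, hk, map_add, map_mul, hc, hd]
  have hd0 : ψ d ≠ 0 := by
    have h1 : i (a - σ a) = d * (y - τ y) := by rw [map_sub, hk, hk']; ring
    have h2 : ψ (i (a - σ a)) ≠ 0 := ((ha.map i).map ψ).ne_zero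
    rw [h1, map_mul] at h2
    exact left_ne_zero_of_mul h2
  have h3 := he a
  rw [hk, hk', map_add, map_mul, hθ c hc, hθ d hd, map_add, map_mul, map_add, map_mul] at h3
  refine smul_right_injective A hd0 ?_
  simp only
  rw [smul_mul_assoc, one_mul, ← eq_sub_iff_add_eq'] at h3
  rw [h3]
  module

end Quadratic

section MatrixPair

variable {k n : Type*} [Field k] [Fintype n] [DecidableEq n]

theorem Matrix.exists_unit_of_idempotent_pair {e f s e' f' s' : Matrix n n k}
    (he : IsIdempotentElem e) (hf : IsIdempotentElem f) (hs : s = (e + f - 1) ^ 2)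
    (hu : IsUnit (e + f - 1)) (hu' : IsUnit (e - f))
    (hdeg : Fintype.card n ≤ 2 * (minpoly k s).natDegree)
    (he' : IsIdempotentElem e') (hf' : IsIdempotentElem f') (hs' : s' = (e' + f' - 1) ^ 2)
    (hv : IsUnit (e' + f' - 1)) (hv' : IsUnit (e' - f'))
    (hdeg' : Fintype.card n ≤ 2 * (minpoly k s').natDegree)
    (hss' : s.charpoly = s'.charpoly) :
    ∃ g : (Matrix n n k)ˣ, (g : Matrix n n k) * e = e' * g ∧ (g : Matrix n n k) * f = f' * g := by
  let T : Matrix n n k ≃ₐ[k] Module.End k (n → k) := Matrix.toLinAlgEquiv'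
  obtain ⟨g, hge, hgf⟩ := exists_linearEquiv_of_idempotent_pair (s := T s) (s' := T s')
    (he.map T) (hf.map T)
    (by rw [← map_add, ← map_one T, ← map_sub, ← map_pow, hs])
    (by rw [← map_add, ← map_one T, ← map_sub]; exact hu.map T)
    (by rw [← map_sub]; exact hu'.map T)
    (by rw [minpoly.algEquiv_eq, Module.finrank_fintype_fun_eq_card]; exact hdeg)
    (he'.map T) (hf'.map T)
    (by rw [← map_add, ← map_one T, ← map_sub, ← map_pow, hs'])
    (by rw [← map_add, ← map_one T, ← map_sub]; exact hv.map T)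
    (by rw [← map_sub]; exact hv'.map T)
    (by rw [minpoly.algEquiv_eq, Module.finrank_fintype_fun_eq_card]; exact hdeg')
    ((Matrix.charpoly_toLin' s).trans (hss'.trans (Matrix.charpoly_toLin' s').symm))
  let G : (Matrix n n k)ˣ :=
    Units.map (T.symm : Module.End k (n → k) →* Matrix n n k)
      (LinearMap.GeneralLinearGroup.ofLinearEquiv g)
  have hG : T (G : Matrix n n k) = g := T.apply_symm_apply _
  exact ⟨G, T.injective (by rw [map_mul, map_mul, hG]; exact LinearMap.ext hge),
    T.injective (by rw [map_mul, map_mul, hG]; exact LinearMap.ext hgf)⟩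

theorem Matrix.commute_of_commute_idempotent_pair {e f s : Matrix n n k}
    (he : IsIdempotentElem e) (hf : IsIdempotentElem f) (hs : s = (e + f - 1) ^ 2)
    (hu : IsUnit (e + f - 1)) (hu' : IsUnit (e - f))
    (hdeg : Fintype.card n ≤ 2 * (minpoly k s).natDegree) {c d : Matrix n n k}
    (hce : Commute c e) (hcf : Commute c f) (hde : Commute d e) (hdf : Commute d f) :
    Commute c d := by
  let T : Matrix n n k ≃ₐ[k] Module.End k (n → k) := Matrix.toLinAlgEquiv'
  have key : ∀ {c}, Commute c e → Commute c f → ∃ q : k[X], T c = aeval (T s) q :=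
    fun hce hcf => exists_aeval_of_commute_idempotent_pair (he.map T) (hf.map T)
      (by rw [← map_add, ← map_one T, ← map_sub, ← map_pow, hs])
      (by rw [← map_add, ← map_one T, ← map_sub]; exact hu.map T)
      (by rw [← map_sub]; exact hu'.map T)
      (by rw [minpoly.algEquiv_eq, Module.finrank_fintype_fun_eq_card]; exact hdeg)
      (hce.map T) (hcf.map T)
  obtain ⟨p, hp⟩ := key hce hcf
  obtain ⟨q, hq⟩ := key hde hdf
  refine T.injective ?_
  rw [map_mul, map_mul, hp, hq, ← map_mul, mul_comm, map_mul]

end MatrixPair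

end

theorem exists_finiteDimensional_field_algHom (F K : Type u) [Field F] [CommRing K] [Nontrivial K]
    [Algebra F K] [FiniteDimensional F K] :
    ∃ (Ω : Type u) (_ : Field Ω) (_ : Algebra F Ω) (_ : FiniteDimensional F Ω),
      Nonempty (K →ₐ[F] Ω) := by
  obtain ⟨m, hm⟩ := Ideal.exists_maximal K
  let _ : Field (K ⧸ m) := Ideal.Quotient.field m
  exact ⟨K ⧸ m, inferInstance, inferInstance,
    Module.Finite.of_surjective (Ideal.Quotient.mkₐ F m).toLinearMap Ideal.Quotient.mk_surjective,
    ⟨Ideal.Quotient.mkₐ F m⟩⟩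

theorem SemiconjBy.smul_add_smul_one_sub {k A : Type*} [CommRing k] [Ring A] [Algebra k A]
    {g e e' : A} (h : SemiconjBy g e e') (p q : k) :
    SemiconjBy g (p • e + q • (1 - e)) (p • e' + q • (1 - e')) := by
  simp only [SemiconjBy, mul_add, add_mul, mul_sub, sub_mul, mul_smul_comm, smul_mul_assoc,
    mul_one, one_mul, h.eq]

theorem SemiconjBy.of_smul_add_smul_one_sub {k A : Type*} [Field k] [Ring A] [Algebra k A]
    {g e e' : A} {p q : k} (hpq : p ≠ q)
    (h : SemiconjBy g (p • e + q • (1 - e)) (p • e' + q • (1 - e'))) : SemiconjBy g e e' := by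
  refine smul_right_injective A (sub_ne_zero.2 hpq) ?_
  simp only [SemiconjBy, mul_add, add_mul, mul_sub, sub_mul, mul_smul_comm, smul_mul_assoc,
    mul_one, one_mul] at h
  simp only [sub_smul]
  rw [sub_eq_add_neg, sub_eq_add_neg, ← add_right_inj (q • g)]
  convert h using 1 <;> module

theorem intertwines_of_quadratic {F K₁ K A : Type*} [Field F] [CommRing K₁] [Algebra F K₁]
    [CommRing K] [Algebra F K] [Ring A] [Algebra F A] {σ : K₁ ≃ₐ[F] K₁} {a : K₁}
    (ha : IsUnit (a - σ a)) {τ : K ≃ₐ[F] K} (i : K₁ →ₐ[F] K) (hi : ∀ x, τ (i x) = i (σ x)) {y : K}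
    (hy : ∀ k, ∃ c d, τ c = c ∧ τ d = d ∧ k = c + d * y) (θ θ' : K →ₐ[F] A) {u : A}
    (hfix : ∀ c, τ c = c → u * θ c = θ' c * u) (hu : ∀ x, u * θ (i x) = θ' (i x) * u) (k : K) :
    u * θ k = θ' k * u := by
  have hy' : u * θ y = θ' y * u := by
    obtain ⟨c, d, hc, hd, hk⟩ := hy (i a)
    have hdu : IsUnit d := by
      have h1 : i (a - σ a) = d * (y - τ y) := by
        rw [map_sub, ← hi, hk, map_add, map_mul, hc, hd]; ring
      exact isUnit_of_mul_isUnit_left (h1 ▸ ha.map i)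
    refine (hdu.map θ').mul_left_cancel ?_
    have h2 := hu a
    rw [hk, map_add, map_add, mul_add, add_mul, hfix c hc, add_right_inj, map_mul, map_mul,
      ← mul_assoc, hfix d hd, mul_assoc, mul_assoc] at h2
    exact h2
  obtain ⟨c, d, hc, hd, rfl⟩ := hy k
  rw [map_add, map_add, mul_add, add_mul, hfix c hc, map_mul, map_mul, ← mul_assoc, hfix d hd,
    mul_assoc, hy', mul_assoc]

section Associated

variable {F K₁ K₂ : Type u} [Field F] [CommRing K₁] [CommRing K₂] [Algebra F K₁] [Algebra F K₂]
  {σ₁ : K₁ ≃ₐ[F] K₁} {σ₂ : K₂ ≃ₐ[F] K₂}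

theorem mem_K3_iff {c : K₁ ⊗[F] K₂} : c ∈ K3 σ₁ σ₂ ↔ tau3 σ₁ σ₂ c = c :=
  AlgHom.mem_equalizer _ _ _

theorem tau3_tau3 (hσ₁ : ∀ x, σ₁ (σ₁ x) = x) (hσ₂ : ∀ x, σ₂ (σ₂ x) = x) (c : K₁ ⊗[F] K₂) :
    tau3 σ₁ σ₂ (tau3 σ₁ σ₂ c) = c := by
  induction c with
  | zero => simp
  | add x y hx hy => rw [map_add, map_add, hx, hy]
  | tmul x y => simp [tau3, hσ₁, hσ₂]

theorem exists_fixed_of_generator {y : K₁ ⊗[F] K₂}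
    (hygen : ∀ k : K₁ ⊗[F] K₂, ∃ a b : K3 σ₁ σ₂, k = (a : K₁ ⊗[F] K₂) + (b : K₁ ⊗[F] K₂) * y)
    (k : K₁ ⊗[F] K₂) :
    ∃ c d, tau3 σ₁ σ₂ c = c ∧ tau3 σ₁ σ₂ d = d ∧ k = c + d * y := by
  obtain ⟨c, d, h⟩ := hygen k
  exact ⟨c, d, mem_K3_iff.1 c.2, mem_K3_iff.1 d.2, h⟩

variable {n : Type*} [Fintype n] [DecidableEq n]
  {Φ₁ : K₁ →ₐ[F] Matrix n n F} {Φ₂ : K₂ →ₐ[F] Matrix n n F}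
  {Φt₁ Φt₂ : (K₁ ⊗[F] K₂) →ₐ[F] Matrix n n (K3 σ₁ σ₂)}

theorem map_associated_element {a₁ : K₁} {a₂ : K₂} (ha₁ : IsUnit (a₁ - σ₁ a₁))
    (ha₂ : IsUnit (a₂ - σ₂ a₂)) (hσ₁ : ∀ x, σ₁ (σ₁ x) = x) (hσ₂ : ∀ x, σ₂ (σ₂ x) = x)
    {y : K₁ ⊗[F] K₂}
    (hygen : ∀ k : K₁ ⊗[F] K₂, ∃ a b : K3 σ₁ σ₂, k = (a : K₁ ⊗[F] K₂) + (b : K₁ ⊗[F] K₂) * y)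
    (hyunit : IsUnit (y - tau3 σ₁ σ₂ y))
    (hΦt₁ : ∀ x : K₁, Φt₁ (x ⊗ₜ[F] (1 : K₂)) = (Φ₁ x).map (algebraMap F (K3 σ₁ σ₂)))
    (hΦt₂ : ∀ x : K₂, Φt₂ ((1 : K₁) ⊗ₜ[F] x) = (Φ₂ x).map (algebraMap F (K3 σ₁ σ₂)))
    (hΦt₁c : ∀ c : K3 σ₁ σ₂, Φt₁ (c : K₁ ⊗[F] K₂) = algebraMap _ _ c)
    (hΦt₂c : ∀ c : K3 σ₁ σ₂, Φt₂ (c : K₁ ⊗[F] K₂) = algebraMap _ _ c)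
    {s : Matrix n n (K3 σ₁ σ₂)}
    (hs : s = Ring.inverse (Φt₁ ((y - tau3 σ₁ σ₂ y) ^ 2)) * (Φt₁ y - Φt₂ (tau3 σ₁ σ₂ y)) ^ 2)
    {Ω : Type*} [Field Ω] [Algebra F Ω] (ψ : (K₁ ⊗[F] K₂) →ₐ[F] Ω) {e f : Matrix n n Ω}
    (he : ∀ x, (Φ₁ x).map (algebraMap F Ω) = ψ (x ⊗ₜ 1) • e + ψ (σ₁ x ⊗ₜ 1) • (1 - e))
    (hf : ∀ x, (Φ₂ x).map (algebraMap F Ω) = ψ (1 ⊗ₜ x) • f + ψ (1 ⊗ₜ σ₂ x) • (1 - f)) :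
    s.map (ψ.comp (K3 σ₁ σ₂).val) = (e + f - 1) ^ 2 := by
  let ρ : Matrix n n (K3 σ₁ σ₂) →ₐ[F] Matrix n n Ω := (ψ.comp (K3 σ₁ σ₂).val).mapMatrix
  have hρ : ∀ x : Matrix n n F, ρ (x.map (algebraMap F (K3 σ₁ σ₂))) = x.map (algebraMap F Ω) := by
    intro x
    ext i j
    exact (ψ.comp (K3 σ₁ σ₂).val).commutes _
  have hρc : ∀ c : K3 σ₁ σ₂, ρ (algebraMap _ _ c) = ψ c • 1 := by
    intro c
    ext i j
    by_cases hij : i = j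
    · subst hij; simp [ρ, Matrix.algebraMap_matrix_apply]
    · simp [ρ, Matrix.algebraMap_matrix_apply, hij]
  have hθ₁ : ∀ c, tau3 σ₁ σ₂ c = c → ρ (Φt₁ c) = ψ c • 1 := fun c hc => by
    rw [hΦt₁c ⟨c, mem_K3_iff.2 hc⟩, hρc]
  have hθ₂ : ∀ c, tau3 σ₁ σ₂ c = c → ρ (Φt₂ c) = ψ c • 1 := fun c hc => by
    rw [hΦt₂c ⟨c, mem_K3_iff.2 hc⟩, hρc]
  have h₁ := apply_generator_of_quadratic ha₁ Algebra.TensorProduct.includeLeft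
    (fun x => by simp [tau3]) (exists_fixed_of_generator hygen) ψ (ρ.comp Φt₁) hθ₁ (e := e)
    (fun x => by simp [hΦt₁, hρ, he])
  have h₂ := apply_generator_of_quadratic ha₂ Algebra.TensorProduct.includeRight
    (fun x => by simp [tau3]) (exists_fixed_of_generator hygen) ψ (ρ.comp Φt₂) hθ₂ (e := f)
    (fun x => by simp [hΦt₂, hρ, hf])
  rw [AlgHom.comp_apply] at h₁ h₂
  have h₃ : ρ (Φt₂ (tau3 σ₁ σ₂ y)) = (ψ y + ψ (tau3 σ₁ σ₂ y)) • 1 - ρ (Φt₂ y) := by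
    rw [eq_sub_iff_add_eq, ← map_add, ← map_add, ← map_add, add_comm (tau3 σ₁ σ₂ y)]
    exact hθ₂ _ (by rw [map_add, tau3_tau3 hσ₁ hσ₂, add_comm])
  have h₄ : ρ (Φt₁ y - Φt₂ (tau3 σ₁ σ₂ y)) = ψ (y - tau3 σ₁ σ₂ y) • (e + f - 1) := by
    rw [map_sub, h₃, h₁, h₂, map_sub]
    module
  have h₅ : ρ (Φt₁ ((y - tau3 σ₁ σ₂ y) ^ 2)) = ψ (y - tau3 σ₁ σ₂ y) ^ 2 • 1 := by
    rw [← map_pow]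
    exact hθ₁ _ (by rw [map_pow, map_sub, tau3_tau3 hσ₁ hσ₂]; ring)
  have h₆ := congrArg ρ (Ring.mul_inverse_cancel_left _ ((Φt₁ y - Φt₂ (tau3 σ₁ σ₂ y)) ^ 2)
    ((hyunit.pow 2).map Φt₁))
  rw [← hs, map_mul, h₅, map_pow, h₄, smul_pow, smul_mul_assoc, one_mul] at h₆
  exact smul_right_injective _ (pow_ne_zero 2 (hyunit.map ψ).ne_zero) h₆

theorem associated_element_intertwines {a₁ : K₁} {a₂ : K₂} (ha₁ : IsUnit (a₁ - σ₁ a₁))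
    (ha₂ : IsUnit (a₂ - σ₂ a₂)) {y : K₁ ⊗[F] K₂}
    (hygen : ∀ k : K₁ ⊗[F] K₂, ∃ a b : K3 σ₁ σ₂, k = (a : K₁ ⊗[F] K₂) + (b : K₁ ⊗[F] K₂) * y)
    (hyunit : IsUnit (y - tau3 σ₁ σ₂ y))
    (hΦt₁ : ∀ x : K₁, Φt₁ (x ⊗ₜ[F] (1 : K₂)) = (Φ₁ x).map (algebraMap F (K3 σ₁ σ₂)))
    (hΦt₂ : ∀ x : K₂, Φt₂ ((1 : K₁) ⊗ₜ[F] x) = (Φ₂ x).map (algebraMap F (K3 σ₁ σ₂)))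
    (hΦt₁c : ∀ c : K3 σ₁ σ₂, Φt₁ (c : K₁ ⊗[F] K₂) = algebraMap _ _ c)
    (hΦt₂c : ∀ c : K3 σ₁ σ₂, Φt₂ (c : K₁ ⊗[F] K₂) = algebraMap _ _ c)
    {s : Matrix n n (K3 σ₁ σ₂)}
    (hs : s = Ring.inverse (Φt₁ ((y - tau3 σ₁ σ₂ y) ^ 2)) * (Φt₁ y - Φt₂ (tau3 σ₁ σ₂ y)) ^ 2)
    {Φ₁' : K₁ →ₐ[F] Matrix n n F} {Φ₂' : K₂ →ₐ[F] Matrix n n F}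
    {Φt₁' Φt₂' : (K₁ ⊗[F] K₂) →ₐ[F] Matrix n n (K3 σ₁ σ₂)}
    (hΦt₁' : ∀ x : K₁, Φt₁' (x ⊗ₜ[F] (1 : K₂)) = (Φ₁' x).map (algebraMap F (K3 σ₁ σ₂)))
    (hΦt₂' : ∀ x : K₂, Φt₂' ((1 : K₁) ⊗ₜ[F] x) = (Φ₂' x).map (algebraMap F (K3 σ₁ σ₂)))
    (hΦt₁c' : ∀ c : K3 σ₁ σ₂, Φt₁' (c : K₁ ⊗[F] K₂) = algebraMap _ _ c)
    (hΦt₂c' : ∀ c : K3 σ₁ σ₂, Φt₂' (c : K₁ ⊗[F] K₂) = algebraMap _ _ c)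
    {s' : Matrix n n (K3 σ₁ σ₂)}
    (hs' : s' = Ring.inverse (Φt₁' ((y - tau3 σ₁ σ₂ y) ^ 2)) *
      (Φt₁' y - Φt₂' (tau3 σ₁ σ₂ y)) ^ 2)
    {b : Matrix n n F} (hb₁ : ∀ x, b * Φ₁ x = Φ₁' x * b) (hb₂ : ∀ x, b * Φ₂ x = Φ₂' x * b) :
    b.map (algebraMap F (K3 σ₁ σ₂)) * s = s' * b.map (algebraMap F (K3 σ₁ σ₂)) := by
  have h₁ := intertwines_of_quadratic ha₁ (τ := tau3 σ₁ σ₂) Algebra.TensorProduct.includeLeft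
    (fun x => by simp [tau3]) (exists_fixed_of_generator hygen) Φt₁ Φt₁'
    (u := b.map (algebraMap F (K3 σ₁ σ₂)))
    (fun c hc => by
      rw [hΦt₁c ⟨c, mem_K3_iff.2 hc⟩, hΦt₁c' ⟨c, mem_K3_iff.2 hc⟩]
      exact (Algebra.commutes _ _).symm)
    (fun x => by
      simp only [Algebra.TensorProduct.includeLeft_apply, hΦt₁, hΦt₁']
      rw [← Matrix.map_mul, ← Matrix.map_mul, hb₁])
  have h₂ := intertwines_of_quadratic ha₂ (τ := tau3 σ₁ σ₂) Algebra.TensorProduct.includeRight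
    (fun x => by simp [tau3]) (exists_fixed_of_generator hygen) Φt₂ Φt₂'
    (u := b.map (algebraMap F (K3 σ₁ σ₂)))
    (fun c hc => by
      rw [hΦt₂c ⟨c, mem_K3_iff.2 hc⟩, hΦt₂c' ⟨c, mem_K3_iff.2 hc⟩]
      exact (Algebra.commutes _ _).symm)
    (fun x => by
      simp only [Algebra.TensorProduct.includeRight_apply, hΦt₂, hΦt₂']
      rw [← Matrix.map_mul, ← Matrix.map_mul, hb₂])
  have hu := (hyunit.pow 2).map Φt₁
  have hu' := (hyunit.pow 2).map Φt₁'
  refine hu'.mul_left_cancel ?_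
  have h₃ : b.map (algebraMap F (K3 σ₁ σ₂)) * (Φt₁ y - Φt₂ (tau3 σ₁ σ₂ y)) =
      (Φt₁' y - Φt₂' (tau3 σ₁ σ₂ y)) * b.map (algebraMap F (K3 σ₁ σ₂)) := by
    rw [mul_sub, sub_mul, h₁, h₂]
  rw [← mul_assoc, ← h₁, mul_assoc, ← mul_assoc (Φt₁' _) s', hs, hs',
    Ring.mul_inverse_cancel_left _ _ hu, Ring.mul_inverse_cancel_left _ _ hu', pow_two, pow_two,
    ← mul_assoc, h₃, mul_assoc, h₃, mul_assoc]

theorem exists_idempotent_pair {a₁ : K₁} {a₂ : K₂} (ha₁ : IsUnit (a₁ - σ₁ a₁))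
    (ha₂ : IsUnit (a₂ - σ₂ a₂)) (hσ₁ : ∀ x, σ₁ (σ₁ x) = x) (hσ₂ : ∀ x, σ₂ (σ₂ x) = x)
    (hσ₁fix : ∀ x : K₁, σ₁ x = x ↔ ∃ a : F, algebraMap F K₁ a = x)
    (hσ₂fix : ∀ x : K₂, σ₂ x = x ↔ ∃ a : F, algebraMap F K₂ a = x)
    {y : K₁ ⊗[F] K₂}
    (hygen : ∀ k : K₁ ⊗[F] K₂, ∃ a b : K3 σ₁ σ₂, k = (a : K₁ ⊗[F] K₂) + (b : K₁ ⊗[F] K₂) * y)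
    (hyunit : IsUnit (y - tau3 σ₁ σ₂ y))
    (hΦt₁ : ∀ x : K₁, Φt₁ (x ⊗ₜ[F] (1 : K₂)) = (Φ₁ x).map (algebraMap F (K3 σ₁ σ₂)))
    (hΦt₂ : ∀ x : K₂, Φt₂ ((1 : K₁) ⊗ₜ[F] x) = (Φ₂ x).map (algebraMap F (K3 σ₁ σ₂)))
    (hΦt₁c : ∀ c : K3 σ₁ σ₂, Φt₁ (c : K₁ ⊗[F] K₂) = algebraMap _ _ c)
    (hΦt₂c : ∀ c : K3 σ₁ σ₂, Φt₂ (c : K₁ ⊗[F] K₂) = algebraMap _ _ c)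
    {s : Matrix n n (K3 σ₁ σ₂)}
    (hs : s = Ring.inverse (Φt₁ ((y - tau3 σ₁ σ₂ y) ^ 2)) * (Φt₁ y - Φt₂ (tau3 σ₁ σ₂ y)) ^ 2)
    (hsunit : IsUnit s)
    {Ω : Type*} [Field Ω] [Algebra F Ω] (ψ : (K₁ ⊗[F] K₂) →ₐ[F] Ω) :
    ∃ e f : Matrix n n Ω, IsIdempotentElem e ∧ IsIdempotentElem f ∧
      (∀ x, (Φ₁ x).map (algebraMap F Ω) = ψ (x ⊗ₜ 1) • e + ψ (σ₁ x ⊗ₜ 1) • (1 - e)) ∧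
      (∀ x, (Φ₂ x).map (algebraMap F Ω) = ψ (1 ⊗ₜ x) • f + ψ (1 ⊗ₜ σ₂ x) • (1 - f)) ∧
      s.map (ψ.comp (K3 σ₁ σ₂).val) = (e + f - 1) ^ 2 ∧
      IsUnit (e + f - 1) ∧ IsUnit (e - f) := by
  obtain ⟨e, he, he'⟩ : ∃ e : Matrix n n Ω, IsIdempotentElem e ∧
      ∀ x, (Φ₁ x).map (algebraMap F Ω) = ψ (x ⊗ₜ 1) • e + ψ (σ₁ x ⊗ₜ 1) • (1 - e) :=
    ⟨_, quadratic_idempotent hσ₁ hσ₁fix ha₁ (ψ.comp Algebra.TensorProduct.includeLeft)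
      ((Algebra.ofId F Ω).mapMatrix.comp Φ₁) rfl⟩
  obtain ⟨f, hf, hf'⟩ : ∃ f : Matrix n n Ω, IsIdempotentElem f ∧
      ∀ x, (Φ₂ x).map (algebraMap F Ω) = ψ (1 ⊗ₜ x) • f + ψ (1 ⊗ₜ σ₂ x) • (1 - f) :=
    ⟨_, quadratic_idempotent hσ₂ hσ₂fix ha₂ (ψ.comp Algebra.TensorProduct.includeRight)
      ((Algebra.ofId F Ω).mapMatrix.comp Φ₂) rfl⟩
  have hmap : ∀ {e f} (ψ : (K₁ ⊗[F] K₂) →ₐ[F] Ω),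
      (∀ x, (Φ₁ x).map (algebraMap F Ω) = ψ (x ⊗ₜ 1) • e + ψ (σ₁ x ⊗ₜ 1) • (1 - e)) →
      (∀ x, (Φ₂ x).map (algebraMap F Ω) = ψ (1 ⊗ₜ x) • f + ψ (1 ⊗ₜ σ₂ x) • (1 - f)) →
      s.map (ψ.comp (K3 σ₁ σ₂).val) = (e + f - 1) ^ 2 := fun ψ h₁ h₂ =>
    map_associated_element ha₁ ha₂ hσ₁ hσ₂ hygen hyunit hΦt₁ hΦt₂ hΦt₁c hΦt₂c hs ψ h₁ h₂
  have hunit : ∀ ψ : (K₁ ⊗[F] K₂) →ₐ[F] Ω, IsUnit (s.map (ψ.comp (K3 σ₁ σ₂).val)) := fun ψ =>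
    hsunit.map (ψ.comp (K3 σ₁ σ₂).val).mapMatrix
  refine ⟨e, f, he, hf, he', hf', hmap ψ he' hf', ?_, ?_⟩
  · rw [← isUnit_pow_iff two_ne_zero, ← hmap ψ he' hf']
    exact hunit ψ
  · let ψ' := ψ.comp (Algebra.TensorProduct.map (AlgHom.id F K₁) (σ₂ : K₂ →ₐ[F] K₂))
    have h := hmap ψ' (by simpa [ψ'] using he') (f := 1 - f) fun x => by
      rw [sub_sub_cancel, add_comm]
      simpa [ψ', hσ₂] using hf' x
    have h' := hunit ψ'
    rw [h, isUnit_pow_iff two_ne_zero, ← add_sub_assoc, sub_right_comm, add_sub_cancel_right] at h'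
    exact h'


theorem isSemisimpleRing_K3 [Algebra.Etale F K₁] [Algebra.Etale F K₂] [Module.Finite F K₁]
    [Module.Finite F K₂] : IsSemisimpleRing (K3 σ₁ σ₂) := by
  have : Algebra.FormallyUnramified F (K₁ ⊗[F] K₂) := .comp F K₁ _
  have : IsReduced (K₁ ⊗[F] K₂) := Algebra.FormallyUnramified.isReduced_of_field F _
  have : IsReduced (K3 σ₁ σ₂) := isReduced_of_injective (K3 σ₁ σ₂).val Subtype.val_injective
  have : Module.Finite F (K3 σ₁ σ₂) := FiniteDimensional.finiteDimensional_subalgebra _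
  have : IsArtinianRing (K3 σ₁ σ₂) := IsArtinianRing.of_finite F _
  exact IsArtinianRing.isSemisimpleRing_of_isReduced _

end Associated

/-- Two regular semisimple pairs have the same invariant polynomial if and only
if they are conjugate by an element of `GL_{2h}(F)`. -/
theorem same_invariant_iff_conjugate
    (F : Type u) [Field F] (K₁ K₂ : Type u)
    [CommRing K₁] [CommRing K₂] [Algebra F K₁] [Algebra F K₂]
    [Algebra.Etale F K₁] [Algebra.Etale F K₂]
    (hdim₁ : Module.finrank F K₁ = 2) (hdim₂ : Module.finrank F K₂ = 2)
    (σ₁ : K₁ ≃ₐ[F] K₁) (σ₂ : K₂ ≃ₐ[F] K₂)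
    (hσ₁ : ∀ x : K₁, σ₁ (σ₁ x) = x) (hσ₂ : ∀ x : K₂, σ₂ (σ₂ x) = x)
    (hσ₁fix : ∀ x : K₁, σ₁ x = x ↔ ∃ a : F, algebraMap F K₁ a = x)
    (hσ₂fix : ∀ x : K₂, σ₂ x = x ↔ ∃ a : F, algebraMap F K₂ a = x)
    (h : ℕ) (hh : 0 < h)
    -- a fixed `K₃`-generator `y` of `K`
    (y : K₁ ⊗[F] K₂)
    (hygen : ∀ k : K₁ ⊗[F] K₂, ∃ a b : K3 σ₁ σ₂, k = (a : K₁ ⊗[F] K₂) + (b : K₁ ⊗[F] K₂) * y)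
    (hyunit : IsUnit (y - tau3 σ₁ σ₂ y))
    -- the first pair `(Φ₁, Φ₂)` and its associated element `s`
    (Φ₁ : K₁ →ₐ[F] Matrix (Fin (2*h)) (Fin (2*h)) F)
    (Φ₂ : K₂ →ₐ[F] Matrix (Fin (2*h)) (Fin (2*h)) F)
    (Φt₁ Φt₂ : (K₁ ⊗[F] K₂) →ₐ[F] Matrix (Fin (2*h)) (Fin (2*h)) (K3 σ₁ σ₂))
    (hΦt₁ : ∀ x : K₁, Φt₁ (x ⊗ₜ[F] (1 : K₂)) = (Φ₁ x).map (algebraMap F (K3 σ₁ σ₂)))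
    (hΦt₂ : ∀ x : K₂, Φt₂ ((1 : K₁) ⊗ₜ[F] x) = (Φ₂ x).map (algebraMap F (K3 σ₁ σ₂)))
    (hΦt₁c : ∀ c : K3 σ₁ σ₂,
      Φt₁ (c : K₁ ⊗[F] K₂) = algebraMap (K3 σ₁ σ₂) (Matrix (Fin (2*h)) (Fin (2*h)) (K3 σ₁ σ₂)) c)
    (hΦt₂c : ∀ c : K3 σ₁ σ₂,
      Φt₂ (c : K₁ ⊗[F] K₂) = algebraMap (K3 σ₁ σ₂) (Matrix (Fin (2*h)) (Fin (2*h)) (K3 σ₁ σ₂)) c)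
    (s : Matrix (Fin (2*h)) (Fin (2*h)) (K3 σ₁ σ₂))
    (hs : s = Ring.inverse (Φt₁ ((y - tau3 σ₁ σ₂ y) ^ 2)) * (Φt₁ y - Φt₂ (tau3 σ₁ σ₂ y)) ^ 2)
    -- the second pair `(Φ₁', Φ₂')` and its associated element `s'`
    (Φ₁' : K₁ →ₐ[F] Matrix (Fin (2*h)) (Fin (2*h)) F)
    (Φ₂' : K₂ →ₐ[F] Matrix (Fin (2*h)) (Fin (2*h)) F)
    (Φt₁' Φt₂' : (K₁ ⊗[F] K₂) →ₐ[F] Matrix (Fin (2*h)) (Fin (2*h)) (K3 σ₁ σ₂))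
    (hΦt₁' : ∀ x : K₁, Φt₁' (x ⊗ₜ[F] (1 : K₂)) = (Φ₁' x).map (algebraMap F (K3 σ₁ σ₂)))
    (hΦt₂' : ∀ x : K₂, Φt₂' ((1 : K₁) ⊗ₜ[F] x) = (Φ₂' x).map (algebraMap F (K3 σ₁ σ₂)))
    (hΦt₁c' : ∀ c : K3 σ₁ σ₂,
      Φt₁' (c : K₁ ⊗[F] K₂) = algebraMap (K3 σ₁ σ₂) (Matrix (Fin (2*h)) (Fin (2*h)) (K3 σ₁ σ₂)) c)
    (hΦt₂c' : ∀ c : K3 σ₁ σ₂,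
      Φt₂' (c : K₁ ⊗[F] K₂) = algebraMap (K3 σ₁ σ₂) (Matrix (Fin (2*h)) (Fin (2*h)) (K3 σ₁ σ₂)) c)
    (s' : Matrix (Fin (2*h)) (Fin (2*h)) (K3 σ₁ σ₂))
    (hs' : s' = Ring.inverse (Φt₁' ((y - tau3 σ₁ σ₂ y) ^ 2)) * (Φt₁' y - Φt₂' (tau3 σ₁ σ₂ y)) ^ 2)
    -- both pairs are regular semisimple
    (hsunit : IsUnit s)
    (hetale : Algebra.Etale (K3 σ₁ σ₂) (Algebra.adjoin (K3 σ₁ σ₂) {s}))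
    (hfree : Module.Free (K3 σ₁ σ₂) (Algebra.adjoin (K3 σ₁ σ₂) {s}))
    (hrank : Module.finrank (K3 σ₁ σ₂) (Algebra.adjoin (K3 σ₁ σ₂) {s}) = h)
    (hsunit' : IsUnit s')
    (hetale' : Algebra.Etale (K3 σ₁ σ₂) (Algebra.adjoin (K3 σ₁ σ₂) {s'}))
    (hfree' : Module.Free (K3 σ₁ σ₂) (Algebra.adjoin (K3 σ₁ σ₂) {s'}))
    (hrank' : Module.finrank (K3 σ₁ σ₂) (Algebra.adjoin (K3 σ₁ σ₂) {s'}) = h) :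
    Matrix.charpoly s = Matrix.charpoly s' ↔
      ∃ b : (Matrix (Fin (2*h)) (Fin (2*h)) F)ˣ,
        (∀ x : K₁, (b : Matrix (Fin (2*h)) (Fin (2*h)) F) * Φ₁ x * ((b⁻¹ : _ˣ) : _) = Φ₁' x) ∧
        (∀ x : K₂, (b : Matrix (Fin (2*h)) (Fin (2*h)) F) * Φ₂ x * ((b⁻¹ : _ˣ) : _) = Φ₂' x) := by
  obtain ⟨a₁, ha₁⟩ := exists_isUnit_sub_of_quadratic_etale hdim₁ σ₁ hσ₁ hσ₁fix
  obtain ⟨a₂, ha₂⟩ := exists_isUnit_sub_of_quadratic_etale hdim₂ σ₂ hσ₂ hσ₂fix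
  constructor
  · intro hchar
    have : Module.Finite F K₁ := Module.finite_of_finrank_pos (by omega)
    have : Module.Finite F K₂ := Module.finite_of_finrank_pos (by omega)
    have : Nontrivial (K₁ ⊗[F] K₂) := Module.nontrivial_of_finrank_pos (R := F)
      (by rw [Module.finrank_tensorProduct, hdim₁, hdim₂]; omega)
    have : IsSemisimpleRing (K3 σ₁ σ₂) := isSemisimpleRing_K3
    obtain ⟨Ω, _, _, _, ⟨ψ⟩⟩ := exists_finiteDimensional_field_algHom F (K₁ ⊗[F] K₂)
    obtain ⟨e, f, he, hf, hΦe, hΦf, hse, hu, hu'⟩ := exists_idempotent_pair ha₁ ha₂ hσ₁ hσ₂ hσ₁fix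
      hσ₂fix hygen hyunit hΦt₁ hΦt₂ hΦt₁c hΦt₂c hs hsunit ψ
    obtain ⟨e', f', he', hf', hΦe', hΦf', hse', hv, hv'⟩ := exists_idempotent_pair ha₁ ha₂ hσ₁ hσ₂
      hσ₁fix hσ₂fix hygen hyunit hΦt₁' hΦt₂' hΦt₁c' hΦt₂c' hs' hsunit' ψ
    have hdeg := Matrix.le_natDegree_minpoly_map (ψ.comp (K3 σ₁ σ₂).val : K3 σ₁ σ₂ →+* Ω) s
    have hdeg' := Matrix.le_natDegree_minpoly_map (ψ.comp (K3 σ₁ σ₂).val : K3 σ₁ σ₂ →+* Ω) s'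
    rw [hrank] at hdeg
    rw [hrank'] at hdeg'
    have hcharΩ : (s.map (ψ.comp (K3 σ₁ σ₂).val)).charpoly =
        (s'.map (ψ.comp (K3 σ₁ σ₂).val)).charpoly := by
      have h₁ := Matrix.charpoly_map s (ψ.comp (K3 σ₁ σ₂).val : K3 σ₁ σ₂ →+* Ω)
      rw [hchar, ← Matrix.charpoly_map] at h₁
      exact h₁
    obtain ⟨g, hge, hgf⟩ := Matrix.exists_unit_of_idempotent_pair he hf hse hu hu'
      (by rw [Fintype.card_fin]; exact Nat.mul_le_mul_left 2 hdeg) he' hf' hse' hv hv'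
      (by rw [Fintype.card_fin]; exact Nat.mul_le_mul_left 2 hdeg') hcharΩ
    have hg : ∀ i : K₁ ⊕ K₂, (g : Matrix (Fin (2*h)) (Fin (2*h)) Ω) *
        (Sum.elim Φ₁ Φ₂ i).map (algebraMap F Ω) =
        (Sum.elim Φ₁' Φ₂' i).map (algebraMap F Ω) * g := by
      rintro (x | x)
      · simp only [Sum.elim_inl, hΦe, hΦe']
        exact SemiconjBy.smul_add_smul_one_sub hge _ _
      · simp only [Sum.elim_inr, hΦf, hΦf']
        exact SemiconjBy.smul_add_smul_one_sub hgf _ _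
    have hcomm : ∀ c : Matrix (Fin (2*h)) (Fin (2*h)) F,
        (∀ i, Commute c (Sum.elim Φ₁ Φ₂ i)) → Commute (c.map (algebraMap F Ω)) e ∧
          Commute (c.map (algebraMap F Ω)) f := by
      intro c hc
      constructor
      · refine SemiconjBy.of_smul_add_smul_one_sub (p := ψ (a₁ ⊗ₜ 1)) (q := ψ (σ₁ a₁ ⊗ₜ 1)) ?_ ?_
        · rw [← sub_ne_zero, ← map_sub, ← TensorProduct.sub_tmul]
          exact ((ha₁.map (Algebra.TensorProduct.includeLeft : K₁ →ₐ[F] K₁ ⊗[F] K₂)).map ψ).ne_zero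
        · rw [← hΦe]
          exact (hc (Sum.inl a₁)).map (algebraMap F Ω).mapMatrix
      · refine SemiconjBy.of_smul_add_smul_one_sub (p := ψ (1 ⊗ₜ a₂)) (q := ψ (1 ⊗ₜ σ₂ a₂)) ?_ ?_
        · rw [← sub_ne_zero, ← map_sub, ← TensorProduct.tmul_sub]
          exact ((ha₂.map (Algebra.TensorProduct.includeRight : K₂ →ₐ[F] K₁ ⊗[F] K₂)).map ψ).ne_zero
        · rw [← hΦf]
          exact (hc (Sum.inr a₂)).map (algebraMap F Ω).mapMatrix
    obtain ⟨b, hb⟩ := Matrix.exists_intertwining_unit_of_baseChange (Sum.elim Φ₁ Φ₂)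
      (Sum.elim Φ₁' Φ₂') (g := (g : Matrix (Fin (2*h)) (Fin (2*h)) Ω)) (g' := ↑g⁻¹) (by
        intro c d hc hd
        have hcd := Matrix.commute_of_commute_idempotent_pair he hf hse hu hu'
          (by rw [Fintype.card_fin]; exact Nat.mul_le_mul_left 2 hdeg)
          (hcomm c hc).1 (hcomm c hc).2 (hcomm d hd).1 (hcomm d hd).2
        refine Matrix.map_injective (algebraMap F Ω).injective ?_
        simp only [Matrix.map_mul]
        exact hcd)
      hg (fun i => by rw [Units.inv_mul_eq_iff_eq_mul, ← mul_assoc, hg, Units.mul_inv_cancel_right])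
      g.inv_mul
    exact ⟨b, fun x => Units.mul_inv_eq_iff_eq_mul _ |>.2 (hb (Sum.inl x)),
      fun x => Units.mul_inv_eq_iff_eq_mul _ |>.2 (hb (Sum.inr x))⟩
  · rintro ⟨b, hb₁, hb₂⟩
    have hint := associated_element_intertwines ha₁ ha₂ hygen hyunit hΦt₁ hΦt₂ hΦt₁c hΦt₂c hs
      hΦt₁' hΦt₂' hΦt₁c' hΦt₂c' hs' (b := (b : Matrix (Fin (2*h)) (Fin (2*h)) F))
      (fun x => by rw [← hb₁, Units.inv_mul_cancel_right])
      (fun x => by rw [← hb₂, Units.inv_mul_cancel_right])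
    let B : (Matrix (Fin (2*h)) (Fin (2*h)) (K3 σ₁ σ₂))ˣ :=
      Units.map (algebraMap F (K3 σ₁ σ₂)).mapMatrix.toMonoidHom b
    have hB : s' = B.val * s * B⁻¹.val := by
      rw [Units.eq_mul_inv_iff_mul_eq]
      exact hint.symm
    rw [hB, Matrix.coe_units_inv, Matrix.charpoly_units_conj]
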